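/- The serial joint probabilities λ_t(m) = P(S_t = m, Y = y) and the parallel joint probabilities λ_t^P(m) = P(S_t = m, Y_{i(t)} = y|_{i(t)}) differ exactly by the ratio of the observation probabilities: for every t ∈ {1,…,L}, every state m ∈ S, and every observation sequence y with P(Y = y) > 0, one has λ_t(m) = (P(Y = y) / P(Y_{i(t)} = y|_{i(t)})) · λ_t^P(m). -/

import Mathlib

/-!
Finite hidden Markov source over a memoryless channel.
States `S` (with distinguished state `0`), channel output symbols `O`.
A state path is `s : Fin (L+1) → S`; an observation sequence is `y : Fin L → O`,
where index `t : Fin L` represents time `t+1 ∈ {1,…,L}`.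
-/

open scoped Classical in
/-- The probability of an event `A` under the mass function `P`. -/
noncomputable def prob {S O : Type*} [Fintype S] [Fintype O] {L : ℕ}
    (P : (Fin (L + 1) → S) × (Fin L → O) → ℝ)
    (A : (Fin (L + 1) → S) × (Fin L → O) → Prop) : ℝ :=
  ∑ sy : (Fin (L + 1) → S) × (Fin L → O), if A sy then P sy else 0

/-- The conditional probability `P(A | B)`. -/
noncomputable def condProb {S O : Type*} [Fintype S] [Fintype O] {L : ℕ}
    (P : (Fin (L + 1) → S) × (Fin L → O) → ℝ)
    (A B : (Fin (L + 1) → S) × (Fin L → O) → Prop) : ℝ :=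
  prob P (fun sy => A sy ∧ B sy) / prob P B

open scoped Classical in
/-- The function equal to `g` where `D` holds and to `f` elsewhere. -/
noncomputable def splice {ι α : Type*} (D : ι → Prop) (f g : ι → α) : ι → α :=
  fun j => if D j then g j else f j

theorem splice_of_pos {ι α : Type*} {D : ι → Prop} {f g : ι → α} {j : ι} (h : D j) :
    splice D f g j = g j := if_pos h

theorem splice_of_neg {ι α : Type*} {D : ι → Prop} {f g : ι → α} {j : ι} (h : ¬D j) :
    splice D f g j = f j := if_neg h

theorem splice_splice {ι α : Type*} (D : ι → Prop) (f g : ι → α) :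
    splice D (splice D f g) (splice D g f) = f := by
  funext j
  by_cases h : D j <;> simp [splice, h]

/-- The time indices `a < j ≤ b` of a state path. -/
def stateSeg {L : ℕ} (a b : Fin (L + 1)) (j : Fin (L + 1)) : Prop :=
  (a : ℕ) < j ∧ (j : ℕ) ≤ b

/-- The observations made at times `a < k + 1 ≤ b`. -/
def obsSeg {L : ℕ} (a b : Fin (L + 1)) (k : Fin L) : Prop :=
  stateSeg a b k.succ

/-- Exchange the segment `(a, b]` between two outcomes. -/
noncomputable def swapSeg {S O : Type*} {L : ℕ} (a b : Fin (L + 1))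
    (x : ((Fin (L + 1) → S) × (Fin L → O)) × ((Fin (L + 1) → S) × (Fin L → O))) :
    ((Fin (L + 1) → S) × (Fin L → O)) × ((Fin (L + 1) → S) × (Fin L → O)) :=
  ((splice (stateSeg a b) x.1.1 x.2.1, splice (obsSeg a b) x.1.2 x.2.2),
    (splice (stateSeg a b) x.2.1 x.1.1, splice (obsSeg a b) x.2.2 x.1.2))

theorem swapSeg_involutive {S O : Type*} {L : ℕ} (a b : Fin (L + 1)) :
    Function.Involutive (swapSeg (S := S) (O := O) a b) := by
  rintro ⟨⟨s, u⟩, s', v⟩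
  simp [swapSeg, splice_splice]

/-- If two paths agree at the start `a` and the end `b` of a segment, then up to those endpoints
the initial state of every transition is spliced along with its observation. -/
theorem splice_stateSeg_castSucc {S : Type*} {L : ℕ} {a b : Fin (L + 1)}
    {s s' : Fin (L + 1) → S} (ha : s a = s' a) (hb : s b = s' b) (k : Fin L) :
    splice (stateSeg a b) s s' k.castSucc =
      splice (obsSeg a b) (fun k => s k.castSucc) (fun k => s' k.castSucc) k := by
  by_cases h1 : stateSeg a b k.castSucc <;> by_cases h2 : obsSeg a b k
  · rw [splice_of_pos h1, splice_of_pos h2]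
  · have : k.castSucc = b := by
      simp only [stateSeg, obsSeg, Fin.val_castSucc, Fin.val_succ] at h1 h2
      ext; simp only [Fin.val_castSucc]; omega
    rw [splice_of_pos h1, splice_of_neg h2, this, hb]
  · have : k.castSucc = a := by
      simp only [stateSeg, obsSeg, Fin.val_castSucc, Fin.val_succ] at h1 h2
      ext; simp only [Fin.val_castSucc]; omega
    rw [splice_of_neg h1, splice_of_pos h2, this, ha]
  · rw [splice_of_neg h1, splice_of_neg h2]

/-- The weight of a pair of outcomes of a hidden Markov source is unchanged when a segment at
whose endpoints the two paths agree is exchanged. -/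
theorem mul_swapSeg_eq {S O : Type*} [Zero S] [DecidableEq S] {L : ℕ} {a b : Fin (L + 1)}
    {p : S → S → ℝ} {q : O → S → S → ℝ} {P : (Fin (L + 1) → S) × (Fin L → O) → ℝ}
    (hP : ∀ s y, P (s, y) =
      (if s 0 = 0 then (1 : ℝ) else 0) *
        ∏ t : Fin L, p (s t.castSucc) (s t.succ) * q (y t) (s t.castSucc) (s t.succ))
    (x : ((Fin (L + 1) → S) × (Fin L → O)) × ((Fin (L + 1) → S) × (Fin L → O)))
    (ha : x.1.1 a = x.2.1 a) (hb : x.1.1 b = x.2.1 b) :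
    P (swapSeg a b x).1 * P (swapSeg a b x).2 = P x.1 * P x.2 := by
  obtain ⟨⟨s, u⟩, s', v⟩ := x
  have h0 : ¬stateSeg a b 0 := by simp [stateSeg]
  simp only [swapSeg, hP, splice_of_neg h0]
  refine (mul_mul_mul_comm _ _ _ _).trans (Eq.trans ?_ (mul_mul_mul_comm _ _ _ _))
  rw [← Finset.prod_mul_distrib, ← Finset.prod_mul_distrib]
  congr 1
  refine Finset.prod_congr rfl fun k _ => ?_
  rw [splice_stateSeg_castSucc ha hb, splice_stateSeg_castSucc ha.symm hb.symm]
  by_cases h : obsSeg a b k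
  · have h' : stateSeg a b k.succ := h
    simp only [splice_of_pos h, splice_of_pos h']
    exact mul_comm _ _
  · have h' : ¬stateSeg a b k.succ := h
    simp only [splice_of_neg h, splice_of_neg h']

/-- If a hidden Markov source almost surely visits `0` at times `a` and `b`, then exchanging
the segment `(a, b]` preserves the product measure on pairs of outcomes. -/
theorem mul_swapSeg_eq_of_terminating {S O : Type*} [Zero S] [DecidableEq S] {L : ℕ}
    {a b : Fin (L + 1)}
    {p : S → S → ℝ} {q : O → S → S → ℝ} {P : (Fin (L + 1) → S) × (Fin L → O) → ℝ}
    (hP : ∀ s y, P (s, y) =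
      (if s 0 = 0 then (1 : ℝ) else 0) *
        ∏ t : Fin L, p (s t.castSucc) (s t.succ) * q (y t) (s t.castSucc) (s t.succ))
    (ha : ∀ z, P z ≠ 0 → z.1 a = 0) (hb : ∀ z, P z ≠ 0 → z.1 b = 0)
    (x : ((Fin (L + 1) → S) × (Fin L → O)) × ((Fin (L + 1) → S) × (Fin L → O))) :
    P (swapSeg a b x).1 * P (swapSeg a b x).2 = P x.1 * P x.2 := by
  have key : ∀ x, P x.1 * P x.2 ≠ 0 →
      P (swapSeg a b x).1 * P (swapSeg a b x).2 = P x.1 * P x.2 := fun x hx =>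
    have h1 := left_ne_zero_of_mul hx
    have h2 := right_ne_zero_of_mul hx
    mul_swapSeg_eq hP x ((ha _ h1).trans (ha _ h2).symm) ((hb _ h1).trans (hb _ h2).symm)
  by_cases hx : P x.1 * P x.2 = 0
  · by_contra hne
    rw [hx] at hne
    have := key _ hne
    rw [swapSeg_involutive a b x] at this
    exact hne (this.symm.trans hx)
  · exact key x hx

open scoped Classical in
theorem prob_mul_prob {S O : Type*} [Fintype S] [Fintype O] {L : ℕ}
    (P : (Fin (L + 1) → S) × (Fin L → O) → ℝ)
    (A B : (Fin (L + 1) → S) × (Fin L → O) → Prop) :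
    prob P A * prob P B = ∑ x : ((Fin (L + 1) → S) × (Fin L → O)) ×
      ((Fin (L + 1) → S) × (Fin L → O)), if A x.1 ∧ B x.2 then P x.1 * P x.2 else 0 := by
  rw [prob, prob, Fintype.sum_mul_sum]
  refine Eq.trans ?_ (Fintype.sum_prod_type _).symm
  refine Fintype.sum_congr _ _ fun x => Fintype.sum_congr _ _ fun z => ?_
  rw [ite_and]
  split_ifs <;> simp

theorem prob_mono {S O : Type*} [Fintype S] [Fintype O] {L : ℕ}
    {P : (Fin (L + 1) → S) × (Fin L → O) → ℝ} (hP : ∀ z, 0 ≤ P z)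
    {A B : (Fin (L + 1) → S) × (Fin L → O) → Prop} (h : ∀ z, A z → B z) :
    prob P A ≤ prob P B := by
  classical
  refine Finset.sum_le_sum fun z _ => ?_
  by_cases hA : A z
  · simp [hA, h z hA]
  · rw [if_neg hA]
    split_ifs
    exacts [hP z, le_rfl]

/-- Exchanging a segment at whose endpoints the source is almost surely in state `0` turns a pair
of events into another pair with the same product of probabilities. -/
theorem prob_mul_prob_eq_of_swapSeg {S O : Type*} [Fintype S] [Fintype O] [Zero S]
    [DecidableEq S] {L : ℕ} {a b : Fin (L + 1)}
    {p : S → S → ℝ} {q : O → S → S → ℝ} {P : (Fin (L + 1) → S) × (Fin L → O) → ℝ}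
    (hP : ∀ s y, P (s, y) =
      (if s 0 = 0 then (1 : ℝ) else 0) *
        ∏ t : Fin L, p (s t.castSucc) (s t.succ) * q (y t) (s t.castSucc) (s t.succ))
    (ha : ∀ z, P z ≠ 0 → z.1 a = 0) (hb : ∀ z, P z ≠ 0 → z.1 b = 0)
    {A B A' B' : (Fin (L + 1) → S) × (Fin L → O) → Prop}
    (h : ∀ x, A x.1 ∧ B x.2 → A' (swapSeg a b x).1 ∧ B' (swapSeg a b x).2)
    (h' : ∀ x, A' x.1 ∧ B' x.2 → A (swapSeg a b x).1 ∧ B (swapSeg a b x).2) :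
    prob P A * prob P B = prob P A' * prob P B' := by
  classical
  rw [prob_mul_prob, prob_mul_prob]
  refine Fintype.sum_equiv (swapSeg_involutive a b).toPerm _ _ fun x => ?_
  have hiff : (A x.1 ∧ B x.2) ↔ A' (swapSeg a b x).1 ∧ B' (swapSeg a b x).2 :=
    ⟨h x, fun hx => by simpa only [swapSeg_involutive a b x] using h' _ hx⟩
  simp only [Function.Involutive.coe_toPerm, mul_swapSeg_eq_of_terminating hP ha hb, hiff]

/-- **Serial and parallel joint state/observation probabilities differ exactly by the
ratio of the observation probabilities:**
`λ_t(m) = (P(Y = y) / P(Y_{i(t)} = y|_{i(t)})) · λ_t^P(m)`. -/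
theorem serial_parallel_lambda_ratio
    {S O : Type*} [Fintype S] [Fintype O] [Nonempty S] [Nonempty O]
    [Zero S] [DecidableEq S]
    {N L : ℕ} (hN : 1 ≤ N) (hL : 1 ≤ L)
    -- boundary times 0 = L_0 < L_1 < ⋯ < L_N = L
    (Lb : Fin (N + 1) → Fin (L + 1)) (hmono : StrictMono Lb)
    (hLb0 : Lb 0 = 0) (hLbN : Lb (Fin.last N) = Fin.last L)
    -- the factorizing probability mass function
    (p : S → S → ℝ) (q : O → S → S → ℝ)
    (hp : ∀ a b, 0 ≤ p a b) (hq : ∀ o a b, 0 ≤ q o a b)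
    (P : (Fin (L + 1) → S) × (Fin L → O) → ℝ)
    (hP : ∀ s y, P (s, y) =
      (if s 0 = 0 then (1 : ℝ) else 0) *
        ∏ t : Fin L, p (s t.castSucc) (s t.succ) * q (y t) (s t.castSucc) (s t.succ))
    (hsum : ∑ sy : (Fin (L + 1) → S) × (Fin L → O), P sy = 1)
    -- termination: each parallel codeword drives the encoder back to state 0
    (hterm : ∀ s y, P (s, y) ≠ 0 → ∀ i : Fin (N + 1), s (Lb i) = 0)
    -- the state
    (m : S)
    -- the observation sequence, with positive serial probability
    (y : Fin L → O)
    (hy : 0 < prob P (fun sy => sy.2 = y))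
    -- the time t (as an element of Fin L, representing time t+1) and its segment index
    (t : Fin L) (i : Fin N)
    (hti : ((Lb i.castSucc : ℕ) < (t : ℕ) + 1) ∧ ((t : ℕ) + 1 ≤ (Lb i.succ : ℕ))) :
    prob P (fun sy => sy.1 t.succ = m ∧ sy.2 = y) =
      (prob P (fun sy => sy.2 = y) /
        prob P (fun sy => ∀ k : Fin L,
          (Lb i.castSucc : ℕ) < (k : ℕ) + 1 → (k : ℕ) + 1 ≤ (Lb i.succ : ℕ) →
            sy.2 k = y k)) *
      prob P (fun sy => sy.1 t.succ = m ∧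
        ∀ k : Fin L,
          (Lb i.castSucc : ℕ) < (k : ℕ) + 1 → (k : ℕ) + 1 ≤ (Lb i.succ : ℕ) →
            sy.2 k = y k) := by
  have hnn : ∀ z, 0 ≤ P z := by
    rintro ⟨s, u⟩
    rw [hP]
    exact mul_nonneg (by split_ifs <;> norm_num)
      (Finset.prod_nonneg fun k _ => mul_nonneg (hp _ _) (hq _ _ _))
  have hpos := hy.trans_le (prob_mono hnn (A := fun sy => sy.2 = y)
    (B := fun sy => ∀ k : Fin L, (Lb i.castSucc : ℕ) < (k : ℕ) + 1 →
      (k : ℕ) + 1 ≤ (Lb i.succ : ℕ) → sy.2 k = y k)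
    (by rintro z rfl k _ _; rfl))
  have ht : stateSeg (Lb i.castSucc) (Lb i.succ) t.succ := by
    simpa only [stateSeg, Fin.val_succ] using hti
  have hobs : ∀ {u v : Fin L → O}, u = y →
      (∀ k : Fin L, (Lb i.castSucc : ℕ) < (k : ℕ) + 1 →
        (k : ℕ) + 1 ≤ (Lb i.succ : ℕ) → v k = y k) →
      splice (obsSeg (Lb i.castSucc) (Lb i.succ)) u v = y ∧
      ∀ k : Fin L, (Lb i.castSucc : ℕ) < (k : ℕ) + 1 →
        (k : ℕ) + 1 ≤ (Lb i.succ : ℕ) →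
          splice (obsSeg (Lb i.castSucc) (Lb i.succ)) v u k = y k := by
    rintro u v rfl hv
    refine ⟨funext fun k => ?_, fun k h1 h2 => splice_of_pos ⟨by simpa using h1, by simpa using h2⟩⟩
    by_cases hk : obsSeg (Lb i.castSucc) (Lb i.succ) k
    · rw [splice_of_pos hk]
      exact hv k (by simpa using hk.1) (by simpa using hk.2)
    · exact splice_of_neg hk
  rw [div_mul_eq_mul_div, eq_div_iff hpos.ne']
  refine prob_mul_prob_eq_of_swapSeg (a := Lb i.castSucc) (b := Lb i.succ) hP
    (fun z hz => hterm z.1 z.2 hz _) (fun z hz => hterm z.1 z.2 hz _) ?_ ?_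
  · rintro x ⟨⟨hm, hu⟩, hv⟩
    exact ⟨(hobs hu hv).1, (splice_of_pos ht).trans hm, (hobs hu hv).2⟩
  · rintro x ⟨hu, hm, hv⟩
    exact ⟨⟨(splice_of_pos ht).trans hm, (hobs hu hv).1⟩, (hobs hu hv).2⟩
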